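/- arXiv:2012.07573 — 2 statements merged into one kernel-verified Lean document; each statement's English description precedes it below -/
import Mathlib

section
/- Let σ be the ℝ-algebra endomorphism of R sending each variable t_k to t_k/2. Then for every polynomial P in R, σ(W_1 P) = (1/12)·M_{-3}^B(σP) − (t_1^3/144)·σP + (t_3/16)·σP. In other words, conjugation of the Kontsevich–Witten cut-and-join operator W_1 by the rescaling t_k ↦ t_k/2 equals (1/12)M_{-3}^B − t_1^3/(2^4·3^2) + t_3/16. -/
open MvPolynomial

/-- `R` is the polynomial ring over `ℝ` in the variables `t_k`, `k` a positive odd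
integer; the variable `X n` represents `t_{2n+1}`. -/
abbrev PR : Type := MvPolynomial ℕ ℝ

/-- The Kontsevich--Witten cut-and-join operator `W_1`:
`W_1 P = (1/3) Σ_{k,m odd ≥ 1, k+m ≥ 4} k m t_k t_m ∂_{k+m-3} P
 + (1/6) Σ_{k,m odd ≥ 1} (k+m+3) t_{k+m+3} ∂_k ∂_m P + (t_1³/6) P + (t_3/8) P`,
written in the encoding `t_{2a+1} = X a` (for `k = 2a+1`, `m = 2b+1` the condition
`k+m ≥ 4` reads `a+b ≥ 1`, `t_{k+m-3} = X (a+b-1)` and `t_{k+m+3} = X (a+b+2)`). -/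
noncomputable def W1 (P : PR) : PR :=
  (1 / 3 : ℝ) • (∑ᶠ (a : ℕ) (b : ℕ),
      if 1 ≤ a + b then
        ((((2 * a + 1) * (2 * b + 1) : ℕ) : ℝ) • (X a * X b * pderiv (a + b - 1) P))
      else 0)
  + (1 / 6 : ℝ) • (∑ᶠ (a : ℕ) (b : ℕ),
      (((2 * a + 2 * b + 5 : ℕ) : ℝ)) • (X (a + b + 2) * pderiv a (pderiv b P)))
  + (1 / 6 : ℝ) • ((X 0) ^ 3 * P) + (1 / 8 : ℝ) • (X 1 * P)

/-- The BKP `W^{(3)}`-generator `M_{-3}^B`: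
`M_{-3}^B P = Σ_{k,m odd ≥ 1, k+m ≥ 4} 2 k m t_k t_m ∂_{k+m-3} P
 + Σ_{k,m odd ≥ 1} 4(k+m+3) t_{k+m+3} ∂_k ∂_m P + (t_1³/3) P`,
in the same encoding `t_{2a+1} = X a`. -/
noncomputable def MB3 (P : PR) : PR :=
  (∑ᶠ (a : ℕ) (b : ℕ),
      if 1 ≤ a + b then
        (((2 * ((2 * a + 1) * (2 * b + 1)) : ℕ) : ℝ) • (X a * X b * pderiv (a + b - 1) P))
      else 0)
  + (∑ᶠ (a : ℕ) (b : ℕ),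
      (((4 * (2 * a + 2 * b + 5) : ℕ) : ℝ)) • (X (a + b + 2) * pderiv a (pderiv b P)))
  + (1 / 3 : ℝ) • ((X 0) ^ 3 * P)

/-- The `ℝ`-algebra endomorphism `σ` of `R` sending each variable `t_k` to `t_k/2`. -/
noncomputable def halfScale : PR →ₐ[ℝ] PR :=
  aeval (fun n => MvPolynomial.C (1 / 2 : ℝ) * X n)

theorem halfScale_X (n : ℕ) : halfScale (X n) = (1 / 2 : ℝ) • (X n : PR) := by
  simp [halfScale, smul_eq_C_mul]

theorem halfScale_injective : Function.Injective halfScale := by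
  let τ : PR →ₐ[ℝ] PR := aeval fun n => C (2 : ℝ) * X n
  have h : τ.comp halfScale = AlgHom.id ℝ PR := by
    ext1 n
    rw [AlgHom.comp_apply, halfScale_X, map_smul, aeval_X, ← smul_eq_C_mul, smul_smul]
    norm_num
  have h_inv : Function.LeftInverse τ halfScale := fun P => by
    rw [← AlgHom.comp_apply, h, AlgHom.id_apply]
  exact h_inv.injective

theorem pderiv_halfScale (k : ℕ) (P : PR) :
    pderiv k (halfScale P) = (1 / 2 : ℝ) • halfScale (pderiv k P) := by
  induction P using MvPolynomial.induction_on with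
  | C r => simp [halfScale]
  | add p q hp hq => simp only [map_add, hp, hq, smul_add]
  | mul_X p n hp =>
    have hX : pderiv k (X n : PR) = C (if n = k then 1 else 0) := by
      rw [pderiv_X, Pi.single_apply]; split_ifs <;> simp
    have hC (r : ℝ) : halfScale (C r) = C r := by simp [halfScale]
    simp only [map_mul, Derivation.leibniz, halfScale_X, hp, hX, map_add, smul_eq_mul,
      pderiv_C, hC, smul_eq_C_mul]
    ring

theorem halfScale_pderiv (k : ℕ) (P : PR) :
    halfScale (pderiv k P) = (2 : ℝ) • pderiv k (halfScale P) := by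
  rw [pderiv_halfScale, smul_smul]
  norm_num

theorem halfScale_finsum {ι : Type*} (f : ι → PR) :
    halfScale (∑ᶠ i, f i) = ∑ᶠ i, halfScale (f i) :=
  (halfScale : PR →+ PR).map_finsum_of_injective halfScale_injective f

/-- Conjugating the Kontsevich--Witten cut-and-join operator `W_1` by the rescaling
`t_k ↦ t_k/2` gives `(1/12) M_{-3}^B - t_1³/(2⁴·3²) + t_3/16`. -/
theorem statement3 (P : PR) :
    halfScale (W1 P)
      = (1 / 12 : ℝ) • MB3 (halfScale P)
        - (1 / 144 : ℝ) • ((X 0) ^ 3 * halfScale P)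
        + (1 / 16 : ℝ) • (X 1 * halfScale P) := by
  have h_first (a b : ℕ) :
      (1 / 3 : ℝ) • halfScale (if 1 ≤ a + b then
        ((((2 * a + 1) * (2 * b + 1) : ℕ) : ℝ) • (X a * X b * pderiv (a + b - 1) P)) else 0)
      = (1 / 12 : ℝ) • (if 1 ≤ a + b then
        (((2 * ((2 * a + 1) * (2 * b + 1)) : ℕ) : ℝ) •
          (X a * X b * pderiv (a + b - 1) (halfScale P))) else 0) := by
    split_ifs
    · simp only [map_smul, map_mul, halfScale_X, halfScale_pderiv, smul_mul_assoc, mul_smul_comm,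
        smul_smul]
      congr 1
      push_cast
      ring
    · simp
  have h_second (a b : ℕ) :
      (1 / 6 : ℝ) • halfScale
        ((((2 * a + 2 * b + 5 : ℕ) : ℝ)) • (X (a + b + 2) * pderiv a (pderiv b P)))
      = (1 / 12 : ℝ) • ((((4 * (2 * a + 2 * b + 5) : ℕ) : ℝ)) •
        (X (a + b + 2) * pderiv a (pderiv b (halfScale P)))) := by
    simp only [map_smul, map_mul, halfScale_X, halfScale_pderiv, Derivation.map_smul,
      smul_mul_assoc, mul_smul_comm, smul_smul]
    congr 1
    push_cast
    ring
  have h_sums (f g : ℕ → ℕ → PR) (c d : ℝ)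
      (h : ∀ a b, c • halfScale (f a b) = d • g a b) :
      c • halfScale (∑ᶠ (a : ℕ) (b : ℕ), f a b) = d • ∑ᶠ (a : ℕ) (b : ℕ), g a b := by
    simp only [halfScale_finsum, smul_finsum, h]
  rw [W1, MB3, map_add, map_add, map_add, map_smul, map_smul, h_sums _ _ _ _ h_first,
    h_sums _ _ _ _ h_second]
  simp only [map_smul, map_mul, map_pow, halfScale_X, smul_pow, smul_mul_assoc]
  module
end

section
/- For every strict partition λ = (λ_1 > λ_2 > … > λ_ℓ > 0) and every real ħ, the hypergeometric BKP coefficient r_λ associated to the function r(z) = ħ((2z−1)^2 − 4N^2)/16 with N = 0, namely r_λ = ∏_{j=1}^ℓ ∏_{i=1}^{λ_j} (ħ(2i−1)^2/16), satisfies r_λ = (ħ/16)^{|λ|} · ∏_{j=1}^ℓ ((2λ_j − 1)!!)^2, and combined with the hook-ratio identity h(λ) = (∏_{j=1}^ℓ (2λ_j−1)!!)·h(2λ), this yields r_λ · h(λ) = (ħ/16)^{|λ|} · h(λ)^3 / h(2λ)^2; i.e., term by term over strict partitions, the conjectural Schur Q-expansion of the BGW tau-function τ_{BGW} = Σ_{λ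 ∈ DP} (ħ/16)^{|λ|} Q_λ(t) Q_λ(δ_{k,1})^3/Q_{2λ}(δ_{k,1})^2 coincides with the hypergeometric BKP expansion Σ_{λ ∈ DP} r_λ Q_λ(t) Q_λ(δ_{k,1}) determined by r(z) = ħ(2z−1)^2/16. -/
open Finset

/-- Double factorial `(2n-1)!! = ∏_{i=1}^n (2i-1)`, with `(-1)!! = 1`. -/
def dfac (n : ℕ) : ℕ := ∏ i ∈ Finset.range n, (2 * i + 1)

/-- The principal specialization `h(λ) = Q_λ(δ_{k,1})` of the Schur Q-function,
given by Schur's hook-type formula. -/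
noncomputable def hspec (ℓ : ℕ) (lam : Fin ℓ → ℕ) : ℝ :=
  (2 : ℝ) ^ ((∑ j, (lam j : ℝ)) - (ℓ : ℝ) / 2) *
  (∏ j, ((Nat.factorial (lam j) : ℝ))⁻¹) *
  ∏ p ∈ Finset.univ.filter (fun p : Fin ℓ × Fin ℓ => p.1 < p.2),
    (((lam p.1 : ℝ) - (lam p.2 : ℝ)) / ((lam p.1 : ℝ) + (lam p.2 : ℝ)))

theorem dfac_pos (n : ℕ) : 0 < dfac n :=
  Finset.prod_pos fun _ _ => Nat.succ_pos _

theorem factorial_two_mul_eq (n : ℕ) :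
    (2 * n).factorial = 2 ^ n * n.factorial * dfac n := by
  induction n with
  | zero => simp [dfac]
  | succ k ih =>
    have hd : dfac (k + 1) = dfac k * (2 * k + 1) := Finset.prod_range_succ _ _
    rw [show 2 * (k + 1) = 2 * k + 1 + 1 by ring, Nat.factorial_succ, Nat.factorial_succ, ih, hd,
      Nat.factorial_succ k]
    ring

theorem hspec_ne_zero (ℓ : ℕ) (lam : Fin ℓ → ℕ) (hpos : ∀ j, 0 < lam j)
    (hinj : Function.Injective lam) : hspec ℓ lam ≠ 0 := by
  unfold hspec
  refine mul_ne_zero (mul_ne_zero (Real.rpow_pos_of_pos two_pos _).ne' ?_) ?_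
  · exact Finset.prod_ne_zero_iff.mpr fun j _ =>
      inv_ne_zero (Nat.cast_ne_zero.mpr (Nat.factorial_ne_zero _))
  · refine Finset.prod_ne_zero_iff.mpr fun p hp => div_ne_zero (sub_ne_zero.mpr ?_) ?_
    · exact fun h => (Finset.mem_filter.mp hp).2.ne (hinj (Nat.cast_injective h))
    · have := hpos p.1
      positivity

theorem hspec_eq_prod_dfac_mul_hspec_two_mul (ℓ : ℕ) (lam : Fin ℓ → ℕ) :
    hspec ℓ lam = (∏ j, (dfac (lam j) : ℝ)) * hspec ℓ (fun j => 2 * lam j) := by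
  unfold hspec
  have hratio : ∀ p : Fin ℓ × Fin ℓ,
      (((2 * lam p.1 : ℕ) : ℝ) - ((2 * lam p.2 : ℕ) : ℝ)) /
        (((2 * lam p.1 : ℕ) : ℝ) + ((2 * lam p.2 : ℕ) : ℝ)) =
      ((lam p.1 : ℝ) - (lam p.2 : ℝ)) / ((lam p.1 : ℝ) + (lam p.2 : ℝ)) := fun p => by
    push_cast
    rw [← mul_sub, ← mul_add, mul_div_mul_left _ _ two_ne_zero]
  have hpow : (2 : ℝ) ^ ((∑ j, ((2 * lam j : ℕ) : ℝ)) - (ℓ : ℝ) / 2) =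
      (∏ j, (2 : ℝ) ^ lam j) * (2 : ℝ) ^ ((∑ j, (lam j : ℝ)) - (ℓ : ℝ) / 2) := by
    rw [Finset.prod_pow_eq_pow_sum, ← Real.rpow_natCast, ← Real.rpow_add two_pos]
    push_cast
    rw [← Finset.mul_sum]
    ring_nf
  have hfac : ∏ j, ((lam j).factorial : ℝ)⁻¹ =
      (∏ j, (dfac (lam j) : ℝ)) * (∏ j, (2 : ℝ) ^ lam j) *
        ∏ j, ((2 * lam j).factorial : ℝ)⁻¹ := by
    rw [← Finset.prod_mul_distrib, ← Finset.prod_mul_distrib]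
    refine Finset.prod_congr rfl fun j _ => ?_
    have hd : (dfac (lam j) : ℝ) ≠ 0 := Nat.cast_ne_zero.mpr (dfac_pos _).ne'
    have hf : ((lam j).factorial : ℝ) ≠ 0 := Nat.cast_ne_zero.mpr (Nat.factorial_ne_zero _)
    rw [factorial_two_mul_eq]
    push_cast
    field_simp
  simp only [hratio]
  rw [hpow, hfac]
  ring

theorem prod_prod_range_eq (ℓ : ℕ) (lam : Fin ℓ → ℕ) (hbar : ℝ) :
    (∏ j, ∏ i ∈ Finset.range (lam j), (hbar * ((2 * i + 1 : ℕ) : ℝ) ^ 2 / 16))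
      = (hbar / 16) ^ (∑ j, lam j) * ∏ j, ((dfac (lam j) : ℝ)) ^ 2 := by
  rw [← Finset.prod_pow_eq_pow_sum, ← Finset.prod_mul_distrib]
  refine Finset.prod_congr rfl fun j _ => ?_
  rw [dfac, Nat.cast_prod, ← Finset.prod_pow]
  simp only [mul_div_right_comm hbar]
  rw [Finset.prod_mul_distrib, Finset.prod_const, Finset.card_range]

/-- For every strict partition `λ` and real `hbar`, the hypergeometric BKP coefficient
`r_λ = ∏_j ∏_{i=1}^{λ_j} (hbar (2i-1)^2/16)` (for `r(z) = hbar(2z-1)^2/16`, i.e. `N = 0`)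
satisfies `r_λ = (hbar/16)^{|λ|} ∏_j ((2λ_j-1)!!)^2`, and
`r_λ ⬝ h(λ) = (hbar/16)^{|λ|} ⬝ h(λ)^3 / h(2λ)^2`: term by term over strict partitions
the conjectural Schur Q-expansion of `τ_BGW` coincides with the hypergeometric BKP
expansion determined by `r(z) = hbar(2z-1)^2/16`. -/
theorem statement10 (ℓ : ℕ) (lam : Fin ℓ → ℕ) (hpos : ∀ j, 0 < lam j)
    (hanti : StrictAnti lam) (hbar : ℝ) :
    (∏ j, ∏ i ∈ Finset.range (lam j), (hbar * ((2 * i + 1 : ℕ) : ℝ) ^ 2 / 16))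
        = (hbar / 16) ^ (∑ j, lam j) * ∏ j, ((dfac (lam j) : ℝ)) ^ 2
      ∧ (∏ j, ∏ i ∈ Finset.range (lam j), (hbar * ((2 * i + 1 : ℕ) : ℝ) ^ 2 / 16))
            * hspec ℓ lam
        = (hbar / 16) ^ (∑ j, lam j) * hspec ℓ lam ^ 3
            / hspec ℓ (fun j => 2 * lam j) ^ 2 := by
  refine ⟨prod_prod_range_eq ℓ lam hbar, ?_⟩
  have h2 : hspec ℓ (fun j => 2 * lam j) ≠ 0 :=
    hspec_ne_zero ℓ _ (fun j => Nat.mul_pos two_pos (hpos j))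
      fun _ _ h => hanti.injective (Nat.eq_of_mul_eq_mul_left two_pos h)
  rw [prod_prod_range_eq, Finset.prod_pow, eq_div_iff (pow_ne_zero 2 h2),
    hspec_eq_prod_dfac_mul_hspec_two_mul ℓ lam]
  ring
end
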